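/- arXiv:1706.04604 — 4 statements merged into one kernel-verified Lean document; each statement's English description precedes it below -/
import Mathlib

section
/- Let K be an algebraically closed field of characteristic zero and let k ≥ 1 be an integer. The ternary form F := x·y^{k-1}·z^{k+2} + y^{2k}·z² ∈ K[x,y,z] of degree 2k+2 has Waring rank rk F > k² + 3k + 2. -/
open MvPolynomial

/-- The Waring rank of a ternary form `F` with respect to degree `d`:
the least `r` such that `F` is a linear combination of `r` `d`-th powers
of linear forms. -/
noncomputable def waringRank {K : Type*} [Field K] (d : ℕ)
    (F : MvPolynomial (Fin 3) K) : ℕ :=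
  sInf {r : ℕ | ∃ (c : Fin r → K) (ℓ : Fin r → MvPolynomial (Fin 3) K),
    (∀ i, (ℓ i).IsHomogeneous 1) ∧ F = ∑ i, c i • ℓ i ^ d}

section TriangularPairing

variable {K ι M : Type*} [Field K] [Fintype ι] [Fintype M] [DecidableEq K]

/-- If two families of functions pair triangularly with respect to a weighted sum, then the
weight has at least as many nonzero values as the families have members. -/
theorem card_le_card_support_of_triangular (w : ι → K) (f g : M → ι → K) (ρ : M → ℕ)
    (hdiag : ∀ a, ∑ i, w i * f a i * g a i ≠ 0)
    (htri : ∀ a b, b ≠ a → ρ b ≤ ρ a → ∑ i, w i * f b i * g a i = 0) :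
    Fintype.card M ≤ (Finset.univ.filter fun i => w i ≠ 0).card := by
  have hli : LinearIndependent K fun (a : M) (i : {i // w i ≠ 0}) => f a i := by
    rw [Fintype.linearIndependent_iff]
    intro x hx
    by_contra! hne
    obtain ⟨a, ha, hmax⟩ := Finset.exists_max_image (Finset.univ.filter fun a => x a ≠ 0) ρ
      (by obtain ⟨a, ha⟩ := hne; exact ⟨a, by simpa using ha⟩)
    have hxa : x a ≠ 0 := by simpa using ha
    have hzero : ∀ i, w i * ∑ b, x b * f b i = 0 := by
      intro i
      by_cases hi : w i = 0
      · simp [hi]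
      · have := congrFun hx ⟨i, hi⟩
        simp only [Finset.sum_apply, Pi.smul_apply, smul_eq_mul, Pi.zero_apply] at this
        simp [this]
    have hsum : ∑ b, x b * ∑ i, w i * f b i * g a i = 0 := by
      calc ∑ b, x b * ∑ i, w i * f b i * g a i
          = ∑ i, (w i * ∑ b, x b * f b i) * g a i := by
            simp only [Finset.mul_sum, Finset.sum_mul]
            rw [Finset.sum_comm]
            exact Finset.sum_congr rfl fun i _ => Finset.sum_congr rfl fun b _ => by ring
        _ = 0 := by simp [hzero]
    rw [Finset.sum_eq_single a] at hsum
    · exact mul_ne_zero hxa (hdiag a) hsum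
    · intro b _ hba
      by_cases hb : x b = 0
      · simp [hb]
      · rw [htri a b hba (hmax b (by simpa using hb)), mul_zero]
    · simp
  simpa [Fintype.card_subtype] using hli.fintype_card_le_finrank

end TriangularPairing

section PlaneMoments

variable {K ι : Type*} [Field K] [Fintype ι] [DecidableEq K] {k : ℕ} {w a b : ι → K}

/-- A weight on points `(a, b)` of the plane whose only nonzero moment of degree at most `2k + 1`
is that of `a^{k-1}·b^{k+2}` has at least `k(k + 3)` points in its support. -/
theorem card_support_ge_of_moments
    (hzero : ∀ p q, p + q ≤ 2 * k + 1 → ¬(p + 1 = k ∧ q = k + 2) →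
      ∑ i, w i * a i ^ p * b i ^ q = 0)
    (hone : ∀ p, p + 1 = k → ∑ i, w i * a i ^ p * b i ^ (k + 2) ≠ 0) :
    k * (k + 3) ≤ (Finset.univ.filter fun i => w i ≠ 0).card := by
  have hmul : ∀ p q p' q', ∑ i, w i * (a i ^ p * b i ^ q) * (a i ^ p' * b i ^ q') =
      ∑ i, w i * a i ^ (p + p') * b i ^ (q + q') := fun p q p' q' =>
    Finset.sum_congr rfl fun i _ => by ring
  have := card_le_card_support_of_triangular (M := Fin k × Fin (k + 3)) w
    (fun m i => a i ^ (m.1 : ℕ) * b i ^ (m.2 : ℕ))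
    (fun m i => a i ^ (k - 1 - m.1 : ℕ) * b i ^ (k + 2 - m.2 : ℕ))
    (fun m => m.1 + m.2)
    (by
      rintro ⟨⟨p, hp⟩, ⟨q, hq⟩⟩
      simp only [hmul]
      rw [show q + (k + 2 - q) = k + 2 by omega]
      exact hone _ (by omega))
    (by
      rintro ⟨⟨p, hp⟩, ⟨q, hq⟩⟩ ⟨⟨p', hp'⟩, ⟨q', hq'⟩⟩ hne hle
      simp only [ne_eq, Prod.mk.injEq, Fin.mk.injEq] at hne hle
      simp only [hmul]
      exact hzero _ _ (by omega) (by omega))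
  simpa using this

/-- The bound of `card_support_ge_of_moments` improves by three when the moment of `a^{2k}·u²`
is nonzero for some linear form `u`. -/
theorem card_support_ge_of_moments_of_sq_ne_zero
    (hzero : ∀ p q, p + q ≤ 2 * k + 1 → ¬(p + 1 = k ∧ q = k + 2) →
      ∑ i, w i * a i ^ p * b i ^ q = 0)
    (hone : ∀ p, p + 1 = k → ∑ i, w i * a i ^ p * b i ^ (k + 2) ≠ 0)
    (s t : K) (hsq : ∑ i, w i * a i ^ (2 * k) * (s * a i + t * b i) ^ 2 ≠ 0) :
    k * (k + 3) + 3 ≤ (Finset.univ.filter fun i => w i ≠ 0).card := by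
  have hline : ∀ n p q, k ≤ p → p + q + n ≤ 2 * k + 1 →
      ∑ i, w i * a i ^ p * b i ^ q * (s * a i + t * b i) ^ n = 0 := by
    intro n
    induction n with
    | zero => intro p q hp hpq; simpa using hzero p q hpq (by omega)
    | succ n ih =>
      intro p q hp hpq
      calc ∑ i, w i * a i ^ p * b i ^ q * (s * a i + t * b i) ^ (n + 1)
          = s * ∑ i, w i * a i ^ (p + 1) * b i ^ q * (s * a i + t * b i) ^ n
            + t * ∑ i, w i * a i ^ p * b i ^ (q + 1) * (s * a i + t * b i) ^ n := by
            rw [Finset.mul_sum, Finset.mul_sum, ← Finset.sum_add_distrib]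
            exact Finset.sum_congr rfl fun i _ => by ring
        _ = 0 := by rw [ih _ _ (by omega) (by omega), ih _ _ (by omega) (by omega)]; ring
  have hmul : ∀ p q n p' q' n', ∑ i, w i * (a i ^ p * b i ^ q * (s * a i + t * b i) ^ n) *
        (a i ^ p' * b i ^ q' * (s * a i + t * b i) ^ n') =
      ∑ i, w i * a i ^ (p + p') * b i ^ (q + q') * (s * a i + t * b i) ^ (n + n') :=
    fun p q n p' q' n' => Finset.sum_congr rfl fun i _ => by ring
  have := card_le_card_support_of_triangular (M := (Fin k × Fin (k + 3)) ⊕ Fin 3) w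
    (Sum.elim
      (fun m i => a i ^ (m.1 : ℕ) * b i ^ (m.2 : ℕ) * (s * a i + t * b i) ^ 0)
      (fun n i => a i ^ k * b i ^ 0 * (s * a i + t * b i) ^ (n : ℕ)))
    (Sum.elim
      (fun m i => a i ^ (k - 1 - m.1 : ℕ) * b i ^ (k + 2 - m.2 : ℕ) * (s * a i + t * b i) ^ 0)
      (fun n i => a i ^ k * b i ^ 0 * (s * a i + t * b i) ^ (2 - n : ℕ)))
    (Sum.elim (fun m => 2 * (m.1 + m.2) + 1) (fun n => 2 * (k + n)))
    (by
      rintro (⟨⟨p, hp⟩, ⟨q, hq⟩⟩ | ⟨n, hn⟩)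
      · simp only [Sum.elim_inl, hmul]
        rw [show q + (k + 2 - q) = k + 2 by omega]
        simpa using hone (p + (k - 1 - p)) (by omega)
      · simp only [Sum.elim_inr, hmul]
        rw [show n + (2 - n) = 2 by omega, ← two_mul]
        simpa using hsq)
    (by
      rintro (⟨⟨p, hp⟩, ⟨q, hq⟩⟩ | ⟨n, hn⟩) (⟨⟨p', hp'⟩, ⟨q', hq'⟩⟩ | ⟨n', hn'⟩) hne hle
      · simp only [ne_eq, Sum.inl.injEq, Prod.mk.injEq, Fin.mk.injEq, Sum.elim_inl] at hne hle
        simp only [Sum.elim_inl, hmul]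
        simpa using hzero (p' + (k - 1 - p)) (q' + (k + 2 - q)) (by omega) (by omega)
      · simp only [Sum.elim_inl, Sum.elim_inr] at hle
        simp only [Sum.elim_inl, Sum.elim_inr, hmul]
        exact hline _ _ _ (by omega) (by omega)
      · simp only [Sum.elim_inl, Sum.elim_inr] at hle
        simp only [Sum.elim_inl, Sum.elim_inr, hmul]
        exact hline _ _ _ (by omega) (by omega)
      · simp only [ne_eq, Sum.inr.injEq, Fin.mk.injEq, Sum.elim_inr] at hne hle
        simp only [Sum.elim_inr, hmul]
        exact hline _ _ _ (by omega) (by omega))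
  simpa using this

theorem three_le_card_support_of_moments {t : ι → K} (h0 : ∑ i, w i = 0)
    (h1 : ∑ i, w i * t i = 0) (h2 : ∑ i, w i * t i ^ 2 ≠ 0) :
    3 ≤ (Finset.univ.filter fun i => w i ≠ 0).card := by
  have hmul : ∀ p q, ∑ i, w i * t i ^ p * t i ^ q = ∑ i, w i * t i ^ (p + q) := fun p q =>
    Finset.sum_congr rfl fun i _ => by ring
  have := card_le_card_support_of_triangular (M := Fin 3) w
    (fun n i => t i ^ (n : ℕ)) (fun n i => t i ^ (2 - n : ℕ)) (fun n => n)
    (by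
      rintro ⟨n, hn⟩
      simp only [hmul]
      rwa [show n + (2 - n) = 2 by omega])
    (by
      rintro ⟨n, hn⟩ ⟨n', hn'⟩ hne hle
      simp only [ne_eq, Fin.mk.injEq] at hne hle
      simp only [hmul]
      obtain h | h : n' + (2 - n) = 0 ∨ n' + (2 - n) = 1 := by omega
      · simpa [h] using h0
      · simpa [h] using h1)
  simpa using this

end PlaneMoments

section SpaceMoments

variable {K ι : Type*} [Field K] [CharZero K] [Fintype ι]

/-- A weighted point configuration in `K³` whose moments of degree `2k + 2` vanish exactly where
the coefficients of `x·y^{k-1}·z^{k+2} + y^{2k}·z²` do has at least `k(k + 3) + 3` points. -/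
theorem card_ge_of_moments {k : ℕ} (hk : 1 ≤ k) (c x y z : ι → K)
    (hzero : ∀ m p q, m + p + q = 2 * k + 2 → ¬(p + 1 = k ∧ q = k + 2) → ¬(p = 2 * k ∧ q = 2) →
      ∑ i, c i * (x i ^ m * y i ^ p * z i ^ q) = 0)
    (hone : ∀ p, p + 1 = k → ∑ i, c i * (x i ^ 1 * y i ^ p * z i ^ (k + 2)) ≠ 0)
    (htwo : ∑ i, c i * (x i ^ 0 * y i ^ (2 * k) * z i ^ 2) ≠ 0) :
    k * (k + 3) + 3 ≤ Fintype.card ι := by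
  classical
  set w : ι → K := fun i => if x i = 0 then 0 else c i * x i ^ (2 * k + 2) with hw
  set v : ι → K := fun i => if x i = 0 then c i * y i ^ (2 * k + 2) else 0 with hv
  set a : ι → K := fun i => y i / x i with ha
  set b : ι → K := fun i => z i / x i with hb
  have hterm : ∀ m p q, m + p + q = 2 * k + 2 → ∀ i, x i ≠ 0 →
      w i * a i ^ p * b i ^ q = c i * (x i ^ m * y i ^ p * z i ^ q) := by
    intro m p q h i hi
    simp only [hw, hi, if_false, ha, hb, ← h, pow_add, div_pow]
    field_simp
  have hoff : ∀ m p q, m + 1 + p + q = 2 * k + 2 →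
      ∑ i, w i * a i ^ p * b i ^ q = ∑ i, c i * (x i ^ (m + 1) * y i ^ p * z i ^ q) := by
    intro m p q h
    refine Finset.sum_congr rfl fun i _ => ?_
    by_cases hi : x i = 0
    · simp [hw, hi]
    · exact hterm _ _ _ h i hi
  have htop : ∀ p q, p ≠ 0 → p + q = 2 * k + 2 →
      ∑ i, w i * a i ^ p * b i ^ q + ∑ i, v i * (z i / y i) ^ q =
        ∑ i, c i * (x i ^ 0 * y i ^ p * z i ^ q) := by
    intro p q hp h
    rw [← Finset.sum_add_distrib]
    refine Finset.sum_congr rfl fun i _ => ?_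
    by_cases hi : x i = 0
    · by_cases hy : y i = 0
      · simp [hw, hv, hi, hy, hp]
      · simp only [hw, hv, hi, if_true, ← h, pow_add, div_pow]
        field_simp
        ring
    · rw [hterm 0 p q (by omega) i hi]
      simp [hv, hi]
  have hlow : ∀ p q, p + q ≤ 2 * k + 1 → ¬(p + 1 = k ∧ q = k + 2) →
      ∑ i, w i * a i ^ p * b i ^ q = 0 := by
    intro p q h hne
    rw [hoff (2 * k + 1 - p - q) p q (by omega)]
    exact hzero _ _ _ (by omega) hne (by omega)
  have hmid : ∀ p, p + 1 = k → ∑ i, w i * a i ^ p * b i ^ (k + 2) ≠ 0 := by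
    intro p h
    rw [hoff 0 p (k + 2) (by omega)]
    exact hone p h
  by_cases hsq : ∃ s t : K, ∑ i, w i * a i ^ (2 * k) * (s * a i + t * b i) ^ 2 ≠ 0
  · obtain ⟨s, t, hst⟩ := hsq
    exact (card_support_ge_of_moments_of_sq_ne_zero hlow hmid s t hst).trans
      (Finset.card_le_univ _)
  · push Not at hsq
    have g0 : ∑ i, w i * a i ^ (2 * k + 2) * b i ^ 0 = 0 := by
      rw [← hsq 1 0]
      exact Finset.sum_congr rfl fun i _ => by ring
    have g2 : ∑ i, w i * a i ^ (2 * k) * b i ^ 2 = 0 := by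
      rw [← hsq 0 1]
      exact Finset.sum_congr rfl fun i _ => by ring
    have g1 : ∑ i, w i * a i ^ (2 * k + 1) * b i ^ 1 = 0 := by
      have h : ∑ i, w i * a i ^ (2 * k) * (1 * a i + 1 * b i) ^ 2 =
          ∑ i, w i * a i ^ (2 * k + 2) * b i ^ 0 +
            2 * ∑ i, w i * a i ^ (2 * k + 1) * b i ^ 1 +
            ∑ i, w i * a i ^ (2 * k) * b i ^ 2 := by
        rw [Finset.mul_sum, ← Finset.sum_add_distrib, ← Finset.sum_add_distrib]
        exact Finset.sum_congr rfl fun i _ => by ring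
      rw [hsq, g0, g2] at h
      simpa using h.symm
    have l0 := htop (2 * k + 2) 0 (by omega) (by omega)
    have l1 := htop (2 * k + 1) 1 (by omega) (by omega)
    have l2 := htop (2 * k) 2 (by omega) (by omega)
    rw [g0, zero_add, hzero _ _ _ (by omega) (by omega) (by omega)] at l0
    rw [g1, zero_add, hzero _ _ _ (by omega) (by omega) (by omega)] at l1
    rw [g2, zero_add] at l2
    have hcardw := card_support_ge_of_moments hlow hmid
    have hcardv := three_le_card_support_of_moments (by simpa using l0) (by simpa using l1)
      (l2.trans_ne htwo)
    have hdisj : Disjoint (Finset.univ.filter fun i => w i ≠ 0)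
        (Finset.univ.filter fun i => v i ≠ 0) := by
      rw [Finset.disjoint_filter]
      intro i _ hwi
      by_cases hi : x i = 0 <;> simp_all
    calc k * (k + 3) + 3 ≤ _ := add_le_add hcardw hcardv
      _ = _ := (Finset.card_union_of_disjoint hdisj).symm
      _ ≤ _ := Finset.card_le_univ _

end SpaceMoments

section PowersOfLinearForms

variable {K : Type*} [Field K]

/-- Exponent vector of the monomial `x^m·y^p·z^q`. -/
noncomputable def ternaryExponent (m p q : ℕ) : Fin 3 →₀ ℕ :=
  Finsupp.equivFunOnFinite.symm ![m, p, q]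

theorem ternaryExponent_inj {m p q m' p' q' : ℕ} :
    ternaryExponent m p q = ternaryExponent m' p' q' ↔ m = m' ∧ p = p' ∧ q = q' := by
  simp [ternaryExponent, Fin.forall_fin_succ, funext_iff]

theorem X_pow_mul_X_pow_mul_X_pow (m p q : ℕ) :
    (X 0 ^ m * X 1 ^ p * X 2 ^ q : MvPolynomial (Fin 3) K) =
      monomial (ternaryExponent m p q) 1 := by
  rw [monomial_eq, Finsupp.prod_fintype _ _ (by simp)]
  simp [Fin.prod_univ_three, ternaryExponent]

theorem MvPolynomial.IsHomogeneous.eq_sum_smul_X {σ : Type*} [Fintype σ] {ℓ : MvPolynomial σ K}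
    (h : ℓ.IsHomogeneous 1) : ℓ = ∑ j, coeff (Finsupp.single j 1) ℓ • X j := by
  classical
  ext e
  by_cases he : e.degree = 1
  · obtain ⟨j, rfl⟩ := (Finsupp.sum_eq_one_iff e).mp he
    simp [coeff_sum, coeff_X, Finsupp.single_left_inj]
  · rw [h.coeff_eq_zero he, coeff_sum, Finset.sum_eq_zero]
    intro j _
    rw [coeff_smul, coeff_X, if_neg, smul_zero]
    rintro rfl
    simp at he

theorem coeff_linearForm_pow {ℓ : MvPolynomial (Fin 3) K} (h : ℓ.IsHomogeneous 1) (m p q : ℕ) :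
    coeff (ternaryExponent m p q) (ℓ ^ (m + p + q)) =
      (ternaryExponent m p q).multinomial *
        (coeff (Finsupp.single 0 1) ℓ ^ m * coeff (Finsupp.single 1 1) ℓ ^ p *
          coeff (Finsupp.single 2 1) ℓ ^ q) := by
  conv_lhs => rw [h.eq_sum_smul_X]
  rw [coeff_linearCombination_X_pow_of_fintype, if_pos, Finsupp.prod_fintype _ _ (by simp)]
  · simp [Fin.prod_univ_three, ternaryExponent]
  · rw [Finsupp.sum_fintype _ _ (by simp)]
    simp [Fin.sum_univ_three, ternaryExponent]

theorem mem_of_forall_sum_pow_smul_mem [Infinite K] {V : Type*} [AddCommGroup V] [Module K V]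
    (W : Submodule K V) {n : ℕ} {v : ℕ → V}
    (h : ∀ t : K, ∑ i ∈ Finset.range n, t ^ i • v i ∈ W) {i : ℕ} (hi : i < n) : v i ∈ W := by
  by_contra hv
  obtain ⟨f, hf, hW⟩ := Submodule.exists_le_ker_of_notMem hv
  have hpoly : ∑ j ∈ Finset.range n, Polynomial.monomial j (f (v j)) = 0 := by
    refine Polynomial.funext fun t => ?_
    have := hW (h t)
    rw [LinearMap.mem_ker, map_sum] at this
    simpa [Polynomial.eval_finsetSum, mul_comm] using this
  apply hf
  simpa [Polynomial.finsetSum_coeff, Polynomial.coeff_monomial, hi] using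
    congrArg (fun P => Polynomial.coeff P i) hpoly

theorem pow_mul_pow_mem_of_forall_add_smul_pow_mem [CharZero K] {A : Type*} [CommRing A]
    [Algebra K A] (W : Submodule K A) (u v r : A) (m n : ℕ)
    (h : ∀ t : K, r * (u + t • v) ^ (m + n) ∈ W) : r * (u ^ m * v ^ n) ∈ W := by
  have := mem_of_forall_sum_pow_smul_mem W (n := m + n + 1)
    (v := fun i => ((m + n).choose i : K) • (r * (u ^ (m + n - i) * v ^ i))) (i := n)
    (fun t => by
      convert h t using 1
      rw [add_comm u, add_pow, Finset.mul_sum]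
      refine Finset.sum_congr rfl fun i _ => ?_
      simp only [Algebra.smul_def, map_natCast, mul_pow, map_pow]
      ring) (by omega)
  rw [W.smul_mem_iff (by exact_mod_cast (Nat.choose_pos (by omega)).ne')] at this
  simpa using this

theorem monomial_mem_span_linearForm_pow [CharZero K] (m p q : ℕ) :
    (X 0 ^ m * X 1 ^ p * X 2 ^ q : MvPolynomial (Fin 3) K) ∈
      Submodule.span K {G | ∃ ℓ : MvPolynomial (Fin 3) K,
        ℓ.IsHomogeneous 1 ∧ ℓ ^ (m + p + q) = G} := by
  rw [mul_assoc]
  refine pow_mul_pow_mem_of_forall_add_smul_pow_mem _ _ _ _ _ _ fun t => ?_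
  rw [← one_mul (_ * _)]
  refine pow_mul_pow_mem_of_forall_add_smul_pow_mem _ _ _ _ _ _ fun s => ?_
  refine Submodule.subset_span ⟨X 0 + s • (X 1 + t • X 2), ?_, by rw [one_mul, add_assoc]⟩
  simp only [smul_eq_C_mul]
  have hX := isHomogeneous_X K (σ := Fin 3)
  exact (hX 0).add (((hX 1).add ((hX 2).C_mul t)).C_mul s)

end PowersOfLinearForms

/-- The form `x·y^{k-1}·z^{k+2} + y^{2k}·z²` (with `x = X 0`, `y = X 1`, `z = X 2`)
has Waring rank greater than `k² + 3k + 2`. -/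
theorem rank_of_explicit_form (K : Type*) [Field K] [IsAlgClosed K] [CharZero K]
    (k : ℕ) (hk : 1 ≤ k) :
    k ^ 2 + 3 * k + 2 <
      waringRank (2 * k + 2)
        (X 0 * X 1 ^ (k - 1) * X 2 ^ (k + 2) + X 1 ^ (2 * k) * X 2 ^ 2 :
          MvPolynomial (Fin 3) K) := by
  obtain ⟨n, rfl⟩ : ∃ n, k = n + 1 := ⟨k - 1, by omega⟩
  have hF : (X 0 * X 1 ^ (n + 1 - 1) * X 2 ^ (n + 1 + 2) + X 1 ^ (2 * (n + 1)) * X 2 ^ 2 :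
      MvPolynomial (Fin 3) K) =
      X 0 ^ 1 * X 1 ^ n * X 2 ^ (n + 3) + X 0 ^ 0 * X 1 ^ (2 * n + 2) * X 2 ^ 2 := by
    simp only [pow_one, pow_zero, one_mul, Nat.add_sub_cancel, mul_add]
  rw [hF, waringRank]
  set S := {r : ℕ | ∃ (c : Fin r → K) (ℓ : Fin r → MvPolynomial (Fin 3) K),
    (∀ i, (ℓ i).IsHomogeneous 1) ∧
      (X 0 ^ 1 * X 1 ^ n * X 2 ^ (n + 3) + X 0 ^ 0 * X 1 ^ (2 * n + 2) * X 2 ^ 2 :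
        MvPolynomial (Fin 3) K) = ∑ i, c i • ℓ i ^ (2 * (n + 1) + 2)}
  have hne : S.Nonempty := by
    have h₁ := monomial_mem_span_linearForm_pow (K := K) 1 n (n + 3)
    have h₂ := monomial_mem_span_linearForm_pow (K := K) 0 (2 * n + 2) 2
    rw [show 1 + n + (n + 3) = 2 * (n + 1) + 2 by ring] at h₁
    rw [show 0 + (2 * n + 2) + 2 = 2 * (n + 1) + 2 by ring] at h₂
    obtain ⟨r, c, g, hg⟩ := Submodule.mem_span_set'.mp (Submodule.add_mem _ h₁ h₂)
    choose ℓ hℓ hpow using fun i => (g i).2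
    exact ⟨r, c, ℓ, hℓ, by simp only [hpow, hg]⟩
  obtain ⟨c, ℓ, hℓ, hsum⟩ := Nat.sInf_mem hne
  rw [X_pow_mul_X_pow_mul_X_pow, X_pow_mul_X_pow_mul_X_pow] at hsum
  have hmoment : ∀ m p q, m + p + q = 2 * (n + 1) + 2 →
      ((ternaryExponent m p q).multinomial : K) *
        ∑ i, c i * (coeff (Finsupp.single 0 1) (ℓ i) ^ m *
          coeff (Finsupp.single 1 1) (ℓ i) ^ p * coeff (Finsupp.single 2 1) (ℓ i) ^ q) =
      (if 1 = m ∧ n = p ∧ n + 3 = q then 1 else 0) +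
        (if 0 = m ∧ 2 * n + 2 = p ∧ 2 = q then 1 else 0) := by
    intro m p q h
    have := congrArg (coeff (ternaryExponent m p q)) hsum
    simp only [coeff_add, coeff_monomial, ternaryExponent_inj, coeff_sum, coeff_smul, ← h,
      coeff_linearForm_pow (hℓ _), smul_eq_mul] at this
    rw [this, Finset.mul_sum]
    exact Finset.sum_congr rfl fun i _ => by ring
  have hcard := card_ge_of_moments hk c (fun i => coeff (Finsupp.single 0 1) (ℓ i))
    (fun i => coeff (Finsupp.single 1 1) (ℓ i)) (fun i => coeff (Finsupp.single 2 1) (ℓ i))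
    (by
      intro m p q h h₁ h₂
      have := hmoment m p q h
      rw [if_neg (by omega), if_neg (by omega), add_zero] at this
      refine (mul_eq_zero.mp this).resolve_left ?_
      exact_mod_cast (Nat.multinomial_pos _ _).ne')
    (by
      intro p h h0
      have := hmoment 1 p (n + 1 + 2) (by omega)
      rw [if_pos (by omega), if_neg (by omega), h0] at this
      simp at this)
    (by
      intro h0
      have := hmoment 0 (2 * (n + 1)) 2 (by omega)
      rw [if_neg (by omega), if_pos (by omega), h0] at this
      simp at this)
  rw [Fintype.card_fin] at hcard
  nlinarith [hcard]
end

section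
/- Let K be an algebraically closed field of characteristic zero and d ≥ 0. If ℓ₀, ℓ₁, …, ℓ_d are d+1 pairwise linearly independent linear forms in K[y,z], then their d-th powers ℓ₀^d, ℓ₁^d, …, ℓ_d^d are linearly independent over K. -/
open MvPolynomial

/-- A binary form of degree one is a linear combination of the two variables. -/
lemma MvPolynomial.IsHomogeneous.exists_eq_C_mul_X_add_C_mul_X {R : Type*} [CommSemiring R]
    {p : MvPolynomial (Fin 2) R} (hp : p.IsHomogeneous 1) :
    ∃ a b : R, p = C a * X 0 + C b * X 1 := by
  rw [← mem_homogeneousSubmodule, homogeneousSubmodule_one_eq_span_X,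
    Submodule.mem_span_range_iff_exists_fun] at hp
  obtain ⟨c, rfl⟩ := hp
  exact ⟨c 0, c 1, by simp only [Fin.sum_univ_two, smul_eq_C_mul]⟩

/-- The coefficients of a power of a linear polynomial, by the binomial theorem. -/
lemma Polynomial.coeff_C_mul_X_add_C_pow {R : Type*} [CommSemiring R] (a b : R) (d k : ℕ)
    (hk : k ≤ d) :
    ((Polynomial.C a * Polynomial.X + Polynomial.C b) ^ d).coeff k =
      a ^ k * b ^ (d - k) * d.choose k := by
  have hterm (j : ℕ) : (Polynomial.C a * Polynomial.X) ^ j * Polynomial.C b ^ (d - j) *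
      (d.choose j : Polynomial R) =
      Polynomial.C (a ^ j * b ^ (d - j) * d.choose j) * Polynomial.X ^ j := by
    simp only [map_mul, map_pow, map_natCast]
    ring
  rw [add_pow]
  simp only [hterm, Polynomial.finsetSum_coeff, Polynomial.coeff_C_mul_X_pow]
  rw [Finset.sum_ite_eq, if_pos (Finset.mem_range_succ_iff.2 hk)]

/-- `d+1` pairwise linearly independent binary linear forms have linearly
independent `d`-th powers. -/
theorem powers_linearIndependent (K : Type*) [Field K] [IsAlgClosed K] [CharZero K]
    (d : ℕ) (ℓ : Fin (d + 1) → MvPolynomial (Fin 2) K)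
    (hhom : ∀ i, (ℓ i).IsHomogeneous 1)
    (hind : ∀ i j, i ≠ j → LinearIndependent K ![ℓ i, ℓ j]) :
    LinearIndependent K (fun i => ℓ i ^ d) := by
  choose a b hℓ using fun i => (hhom i).exists_eq_C_mul_X_add_C_mul_X
  have hminor (i j) (hij : i ≠ j) : a j * b i - a i * b j ≠ 0 := by
    intro h
    have hp := LinearIndependent.pair_iff.1 (hind i j hij)
    have ha := hp (a j) (-a i) (by
      rw [hℓ i, hℓ j, smul_eq_C_mul, smul_eq_C_mul]
      have h' := congrArg (C (σ := Fin 2)) h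
      simp only [map_sub, map_mul, map_zero, map_neg] at h' ⊢
      linear_combination X 1 * h')
    have hb := hp (b j) (-b i) (by
      rw [hℓ i, hℓ j, smul_eq_C_mul, smul_eq_C_mul]
      have h' := congrArg (C (σ := Fin 2)) h
      simp only [map_sub, map_mul, map_zero, map_neg] at h' ⊢
      linear_combination - X 0 * h')
    have hzero : ℓ i = 0 := by
      rw [hℓ i, neg_eq_zero.1 ha.2, neg_eq_zero.1 hb.2]
      simp
    exact (hind i j hij).ne_zero 0 hzero
  have hdet : (Matrix.projVandermonde a b).det ≠ 0 := by
    rw [Matrix.det_projVandermonde]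
    refine Finset.prod_ne_zero_iff.2 fun i _ => Finset.prod_ne_zero_iff.2 fun j hj => ?_
    exact hminor i j (Finset.mem_Ioi.1 hj).ne
  rw [Fintype.linearIndependent_iff]
  intro g hg
  refine congrFun (Matrix.eq_zero_of_vecMul_eq_zero hdet (v := g) ?_)
  ext k
  have hk : (k : ℕ) ≤ d := Nat.lt_succ_iff.1 k.2
  have hcoeff := congrArg
    (fun p => (aeval ![Polynomial.X, (1 : Polynomial K)] p).coeff (k : ℕ)) hg
  simp only [hℓ, map_sum, map_smul, map_pow, map_add, map_mul, aeval_X, algHom_C,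
    Polynomial.algebraMap_eq, Matrix.cons_val_zero, Matrix.cons_val_one, mul_one,
    Polynomial.finsetSum_coeff, Polynomial.coeff_smul,
    Polynomial.coeff_C_mul_X_add_C_pow _ _ _ _ hk, map_zero, Polynomial.coeff_zero,
    smul_eq_mul, ← mul_assoc, ← Finset.sum_mul] at hcoeff
  have hchoose : (d.choose k : K) ≠ 0 := Nat.cast_ne_zero.2 (Nat.choose_pos hk).ne'
  have hsum := (mul_eq_zero.1 hcoeff).resolve_right hchoose
  simpa [Matrix.vecMul, dotProduct, Matrix.projVandermonde_apply, Fin.val_rev, mul_assoc]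
    using hsum
end

section
/- Let K be an algebraically closed field of characteristic zero and F ∈ K[x,y,z] a form of degree d. For every power sum decomposition F = c₁·ℓ₁^d + ⋯ + c_r·ℓ_r^d with nonzero coefficients c_i and linear forms ℓ_i, the number of indices i such that the coefficient of x in ℓ_i is nonzero is at least al(∂F/∂x) − al(∂²F/∂x²), where al denotes apolar length. -/
open MvPolynomial

/-- The span of all `n`-th order partial derivatives of a ternary polynomial `F`
(with variables `x = X 0`, `y = X 1`, `z = X 2`). -/
noncomputable def derivSpan (K : Type*) [CommSemiring K] (n : ℕ)
    (F : MvPolynomial (Fin 3) K) : Submodule K (MvPolynomial (Fin 3) K) :=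
  Submodule.span K {G | ∃ i j l : ℕ, i + j + l = n ∧
    G = (⇑(pderiv (0 : Fin 3)))^[i] ((⇑(pderiv (1 : Fin 3)))^[j]
          ((⇑(pderiv (2 : Fin 3)))^[l] F))}

/-- The apolar length of `F`: the sum over all `n ≥ 0` of the dimensions of the
spans of the `n`-th order partial derivatives of `F`. -/
noncomputable def apolarLength (K : Type*) [Field K]
    (F : MvPolynomial (Fin 3) K) : ℕ :=
  ∑ n ∈ Finset.range (F.totalDegree + 1), Module.finrank K (derivSpan K n F)

section LinearAlgebra

variable {K V W : Type*} [Field K] [AddCommGroup V] [Module K V] [AddCommGroup W] [Module K W]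

/-- A linear map does not increase the codimension of a nested pair of subspaces. -/
theorem finrank_map_add_finrank_le [FiniteDimensional K V] (f : V →ₗ[K] W)
    {A B : Submodule K V} (h : A ≤ B) :
    Module.finrank K (B.map f) + Module.finrank K A ≤
      Module.finrank K (A.map f) + Module.finrank K B := by
  have rank_nullity (C : Submodule K V) : Module.finrank K (C.map f) +
      Module.finrank K (C ⊓ LinearMap.ker f : Submodule K V) = Module.finrank K C := by
    have h1 := LinearMap.finrank_range_add_finrank_ker (f.domRestrict C)
    rw [LinearMap.range_domRestrict, LinearMap.ker_domRestrict] at h1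
    rw [← h1, ← Submodule.map_comap_subtype,
      LinearEquiv.finrank_eq (Submodule.equivMapOfInjective C.subtype C.injective_subtype _).symm]
  have hA := rank_nullity A
  have hB := rank_nullity B
  have hker : Module.finrank K (A ⊓ LinearMap.ker f : Submodule K V) ≤
      Module.finrank K (B ⊓ LinearMap.ker f : Submodule K V) :=
    Submodule.finrank_mono (inf_le_inf_right _ h)
  omega

end LinearAlgebra

section PowerSum

variable {K ι : Type*} [Field K]

/-- The weighted power sum `∑ k, v k * e k * m (m - 1) ⋯ (m - n + 1) • ℓ k ^ (m - n)`,
linear in the weight vector `v`. -/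
noncomputable def powerSumMap [Fintype ι] (e : ι → K) (ℓ : ι → MvPolynomial (Fin 3) K) (m n : ℕ) :
    (ι → K) →ₗ[K] MvPolynomial (Fin 3) K :=
  Fintype.linearCombination K fun k => (e k * m.descFactorial n) • ℓ k ^ (m - n)

/-- The span of the values of the degree `n` monomials at the points
`(p 0 k, p 1 k, p 2 k)`. -/
def monomialValueSpan (p : Fin 3 → ι → K) (n : ℕ) : Submodule K (ι → K) :=
  Submodule.span K {v | ∃ i j l : ℕ, i + j + l = n ∧ v = p 0 ^ i * (p 1 ^ j * p 2 ^ l)}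

theorem map_mulLeft_monomialValueSpan_le (p : Fin 3 → ι → K) (n : ℕ) :
    (monomialValueSpan p n).map (LinearMap.mulLeft K (p 0)) ≤ monomialValueSpan p (n + 1) := by
  rw [monomialValueSpan, Submodule.map_span, Submodule.span_le]
  rintro _ ⟨_, ⟨i, j, l, h, rfl⟩, rfl⟩
  refine Submodule.subset_span ⟨i + 1, j, l, by omega, ?_⟩
  rw [LinearMap.mulLeft_apply]
  ring

variable [Fintype ι] {e : ι → K} {ℓ : ι → MvPolynomial (Fin 3) K} {p : Fin 3 → ι → K}

theorem pderiv_powerSumMap (hp : ∀ i k, pderiv i (ℓ k) = C (p i k)) (m n : ℕ) (i : Fin 3)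
    (v : ι → K) :
    pderiv i (powerSumMap e ℓ m n v) = powerSumMap e ℓ m (n + 1) (p i * v) := by
  simp only [powerSumMap, Fintype.linearCombination_apply, map_sum, Derivation.map_smul]
  refine Finset.sum_congr rfl fun k _ => ?_
  rw [Derivation.leibniz_pow, hp, Nat.descFactorial_succ, Nat.sub_sub]
  simp only [smul_eq_C_mul, nsmul_eq_mul, smul_eq_mul, Pi.mul_apply, map_mul, map_natCast,
    Nat.cast_mul]
  ring

theorem iterate_pderiv_powerSumMap (hp : ∀ i k, pderiv i (ℓ k) = C (p i k)) (m n : ℕ)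
    (i : Fin 3) (j : ℕ) (v : ι → K) :
    (⇑(pderiv i))^[j] (powerSumMap e ℓ m n v) = powerSumMap e ℓ m (n + j) (p i ^ j * v) := by
  induction j with
  | zero => simp
  | succ j ih =>
    rw [Function.iterate_succ_apply', ih, pderiv_powerSumMap hp, pow_succ', mul_assoc, add_assoc]

theorem derivSpan_powerSumMap (hp : ∀ i k, pderiv i (ℓ k) = C (p i k)) (m t n : ℕ)
    (w : ι → K) :
    derivSpan K n (powerSumMap e ℓ m t w) =
      ((monomialValueSpan p n).map (LinearMap.mulLeft K w)).map (powerSumMap e ℓ m (t + n)) := by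
  rw [derivSpan, monomialValueSpan, Submodule.map_span, Submodule.map_span]
  congr 1
  have key (i j l : ℕ) (h : i + j + l = n) :
      (⇑(pderiv (0 : Fin 3)))^[i] ((⇑(pderiv (1 : Fin 3)))^[j]
          ((⇑(pderiv (2 : Fin 3)))^[l] (powerSumMap e ℓ m t w))) =
        powerSumMap e ℓ m (t + n) (w * (p 0 ^ i * (p 1 ^ j * p 2 ^ l))) := by
    rw [iterate_pderiv_powerSumMap hp, iterate_pderiv_powerSumMap hp,
      iterate_pderiv_powerSumMap hp]
    congr 1
    · congr 1; omega
    · ring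
  ext G
  constructor
  · rintro ⟨i, j, l, h, rfl⟩
    exact ⟨_, ⟨_, ⟨i, j, l, h, rfl⟩, rfl⟩, (key i j l h).symm⟩
  · rintro ⟨_, ⟨_, ⟨i, j, l, h, rfl⟩, rfl⟩, rfl⟩
    exact ⟨i, j, l, h, (key i j l h).symm⟩

theorem sum_finrank_derivSpan_powerSumMap_le (hp : ∀ i k, pderiv i (ℓ k) = C (p i k))
    (h0 : ∀ k, p 0 k ≠ 0) (m N : ℕ) :
    ∑ n ∈ Finset.range (N + 1), Module.finrank K (derivSpan K n (powerSumMap e ℓ m 0 1)) ≤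
      ∑ n ∈ Finset.range N,
        Module.finrank K (derivSpan K n (pderiv 0 (powerSumMap e ℓ m 0 1))) +
      Module.finrank K (monomialValueSpan p N) := by
  have hG (n : ℕ) : derivSpan K n (powerSumMap e ℓ m 0 1) =
      (monomialValueSpan p n).map (powerSumMap e ℓ m n) := by
    rw [derivSpan_powerSumMap hp, LinearMap.mulLeft_one, Submodule.map_id, zero_add]
  induction N with
  | zero =>
    rw [zero_add, Finset.sum_range_one, Finset.sum_range_zero, zero_add, hG]
    exact Submodule.finrank_map_le _ _
  | succ N ih =>
    rw [Finset.sum_range_succ _ (N + 1), Finset.sum_range_succ (fun n =>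
      Module.finrank K (derivSpan K n (pderiv 0 (powerSumMap e ℓ m 0 1)))) N, hG (N + 1)]
    have hGx : derivSpan K N (pderiv 0 (powerSumMap e ℓ m 0 1)) =
        ((monomialValueSpan p N).map (LinearMap.mulLeft K (p 0))).map
          (powerSumMap e ℓ m (N + 1)) := by
      rw [pderiv_powerSumMap hp, derivSpan_powerSumMap hp, mul_one, zero_add, add_comm 1 N]
    have hinj : Function.Injective (LinearMap.mulLeft K (p 0)) := fun u v huv =>
      funext fun k => mul_left_cancel₀ (h0 k) (congrFun huv k)
    have hstep := finrank_map_add_finrank_le (powerSumMap e ℓ m (N + 1))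
      (map_mulLeft_monomialValueSpan_le p N)
    rw [← hGx, ← (Submodule.equivMapOfInjective _ hinj (monomialValueSpan p N)).finrank_eq] at hstep
    omega

end PowerSum

theorem derivSpan_zero (K : Type*) [CommSemiring K] (n : ℕ) :
    derivSpan K n (0 : MvPolynomial (Fin 3) K) = ⊥ := by
  rw [derivSpan, Submodule.span_eq_bot]
  rintro _ ⟨i, j, l, -, rfl⟩
  simp only [iterate_map_zero]

theorem MvPolynomial.IsHomogeneous.pderiv_eq_C {σ R : Type*} [CommSemiring R]
    {ℓ : MvPolynomial σ R} (h : ℓ.IsHomogeneous 1) (i : σ) :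
    pderiv i ℓ = C (ℓ.coeff (Finsupp.single i 1)) := by
  have h0 : (pderiv i ℓ).totalDegree = 0 := Nat.le_zero.mp (h.pderiv (i := i)).totalDegree_le
  rw [totalDegree_eq_zero_iff_eq_C.mp h0, coeff_pderiv]
  simp

theorem sum_finrank_derivSpan_le_apolarLength {K : Type*} [Field K] {m N : ℕ}
    {G : MvPolynomial (Fin 3) K} (hG : G.IsHomogeneous m) (hN : N ≤ m + 1) :
    ∑ n ∈ Finset.range N, Module.finrank K (derivSpan K n G) ≤ apolarLength K G := by
  rcases eq_or_ne G 0 with rfl | hG0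
  · refine (Finset.sum_eq_zero fun n _ => ?_).trans_le (Nat.zero_le _)
    rw [derivSpan_zero, finrank_bot]
  · rw [apolarLength, hG.totalDegree hG0]
    exact Finset.sum_le_sum_of_subset (Finset.range_mono hN)

/-- In every power sum decomposition of `F` with nonzero coefficients, the
number of base linear forms with nonzero coefficient of `x` is at least
`al(∂F/∂x) − al(∂²F/∂x²)`. -/
theorem count_forms_with_x (K : Type*) [Field K] [IsAlgClosed K] [CharZero K]
    (d : ℕ) (F : MvPolynomial (Fin 3) K) (hF : F.IsHomogeneous d)
    (r : ℕ) (c : Fin r → K) (ℓ : Fin r → MvPolynomial (Fin 3) K)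
    (hc : ∀ i, c i ≠ 0)
    (hhom : ∀ i, (ℓ i).IsHomogeneous 1)
    (hdec : F = ∑ i, c i • ℓ i ^ d) :
    (apolarLength K (pderiv 0 F) : ℤ) - apolarLength K (pderiv 0 (pderiv 0 F)) ≤
      ({i : Fin r | (ℓ i).coeff (Finsupp.single 0 1) ≠ 0} : Set (Fin r)).ncard := by
  classical
  let a : Fin r → K := fun k => (ℓ k).coeff (Finsupp.single 0 1)
  let e : {k // a k ≠ 0} → K := fun k => c k * d * a k
  have hp (i : Fin 3) (k : {k // a k ≠ 0}) :
      pderiv i (ℓ k) = C ((ℓ k).coeff (Finsupp.single i 1)) := (hhom k).pderiv_eq_C i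
  have hG : pderiv 0 F = powerSumMap e (fun k => ℓ k) (d - 1) 0 1 := by
    have hterm (k : Fin r) : pderiv 0 (c k • ℓ k ^ d) = (c k * d * a k) • ℓ k ^ (d - 1) := by
      rw [Derivation.map_smul, Derivation.leibniz_pow, (hhom k).pderiv_eq_C]
      simp only [smul_eq_C_mul, nsmul_eq_mul, smul_eq_mul, map_mul, map_natCast, a]
      ring
    simp only [hdec, map_sum, hterm, powerSumMap, Fintype.linearCombination_apply, Pi.one_apply,
      one_smul, Nat.descFactorial_zero, Nat.cast_one, mul_one, Nat.sub_zero, e]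
    exact Finset.sum_congr_set {k | a k ≠ 0} _ _ (fun _ _ => rfl) fun k hk => by
      rw [not_not.mp hk, mul_zero, zero_smul]
  have hbound := sum_finrank_derivSpan_powerSumMap_le (e := e) hp (fun k => k.2) (d - 1)
    (pderiv 0 F).totalDegree
  rw [← hG] at hbound
  have hGx := sum_finrank_derivSpan_le_apolarLength ((hF.pderiv (i := 0)).pderiv (i := 0))
    (N := (pderiv 0 F).totalDegree)
    (by have := (hF.pderiv (i := 0)).totalDegree_le; omega)
  have hcard := Submodule.finrank_le (monomialValueSpan
    (fun i (k : {k // a k ≠ 0}) => (ℓ k).coeff (Finsupp.single i 1)) (pderiv 0 F).totalDegree)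
  rw [Module.finrank_fintype_fun_eq_card, ← Nat.card_eq_fintype_card] at hcard
  change _ ≤ ((Nat.card {k // a k ≠ 0} : ℕ) : ℤ)
  change apolarLength K (pderiv 0 F) ≤ _ at hbound
  omega
end

section
/- Let K be an algebraically closed field of characteristic zero, k ≥ 1, and let H ∈ K[y,z] be a linear combination of at most two (2k+2)-nd powers of pairwise linearly independent linear forms in y and z. Set Fα := x·y^{k-1}·z^{k+2} + y^{2k}·z² − H ∈ K[x,y,z]. Then the apolar length of Fα satisfies al(Fα) > 2k² + 6k + 2. -/
open MvPolynomial

/-- The exponent vector of `x ^ a * y ^ b * z ^ c`. -/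
noncomputable def expVec (a b c : ℕ) : Fin 3 →₀ ℕ :=
  Finsupp.single 0 a + Finsupp.single 1 b + Finsupp.single 2 c

theorem expVec_inj {a b c a' b' c' : ℕ} :
    expVec a b c = expVec a' b' c' ↔ a = a' ∧ b = b' ∧ c = c' := by
  constructor
  · intro h
    have h0 := DFunLike.congr_fun h 0
    have h1 := DFunLike.congr_fun h 1
    have h2 := DFunLike.congr_fun h 2
    simp [expVec] at h0 h1 h2
    exact ⟨h0, h1, h2⟩
  · rintro ⟨rfl, rfl, rfl⟩
    rfl

theorem X_pow_mul_eq_monomial (K : Type*) [CommSemiring K] (a b c : ℕ) :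
    (X 0 ^ a * X 1 ^ b * X 2 ^ c : MvPolynomial (Fin 3) K) = monomial (expVec a b c) 1 := by
  simp [X_pow_eq_monomial, monomial_mul, expVec]

theorem coeff_iterate_pderiv_eq_zero_iff {σ K : Type*} [Field K] [CharZero K]
    (i : σ) (n : ℕ) (m : σ →₀ ℕ) (F : MvPolynomial σ K) :
    coeff m ((⇑(pderiv i))^[n] F) = 0 ↔ coeff (m + Finsupp.single i n) F = 0 := by
  induction n generalizing m with
  | zero => simp
  | succ n ih =>
    rw [Function.iterate_succ_apply', coeff_pderiv]
    have : ((m i : K) + 1) ≠ 0 := Nat.cast_add_one_ne_zero _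
    simp [this, ih, add_assoc, ← Finsupp.single_add, add_comm 1 n]

theorem coeff_iterate_pderiv_expVec {K : Type*} [Field K] [CharZero K]
    (a b c i j l : ℕ) (F : MvPolynomial (Fin 3) K) :
    coeff (expVec a b c) ((⇑(pderiv (0 : Fin 3)))^[i] ((⇑(pderiv (1 : Fin 3)))^[j]
      ((⇑(pderiv (2 : Fin 3)))^[l] F))) = 0 ↔ coeff (expVec (a + i) (b + j) (c + l)) F = 0 := by
  simp only [coeff_iterate_pderiv_eq_zero_iff]
  have : expVec a b c + Finsupp.single 0 i + Finsupp.single 1 j + Finsupp.single 2 l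
      = expVec (a + i) (b + j) (c + l) := by
    simp only [expVec, Finsupp.single_add]; abel
  rw [this]

theorem linearIndependent_of_triangular {ι K M : Type*} [Fintype ι] [Field K] [AddCommGroup M]
    [Module K M] (v : ι → M) (φ : ι → M →ₗ[K] K) (r : ι → ℕ) (hd : ∀ i, φ i (v i) ≠ 0)
    (h0 : ∀ i j, i ≠ j → r i ≤ r j → φ i (v j) = 0) : LinearIndependent K v := by
  rw [Fintype.linearIndependent_iff]
  intro g hg i
  induction hn : r i using Nat.strong_induction_on generalizing i with
  | _ n ih =>
    have h := congrArg (φ i) hg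
    rw [map_sum, map_zero, Finset.sum_eq_single i] at h
    · simpa [hd i] using h
    · intro j _ hj
      rw [map_smul]
      by_cases hr : r i ≤ r j
      · rw [h0 i j hj.symm hr, smul_zero]
      · rw [ih (r j) (by omega) j rfl, zero_smul]
    · simp

instance derivSpan_finite (K : Type*) [Field K] (n : ℕ) (F : MvPolynomial (Fin 3) K) :
    Module.Finite K (derivSpan K n F) := by
  refine FiniteDimensional.span_of_finite K ?_
  refine (Set.finite_range (fun p : Fin (n + 1) × Fin (n + 1) × Fin (n + 1) =>
    (⇑(pderiv (0 : Fin 3)))^[p.1] ((⇑(pderiv (1 : Fin 3)))^[p.2.1]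
          ((⇑(pderiv (2 : Fin 3)))^[p.2.2] F)))).subset ?_
  rintro G ⟨i, j, l, h, rfl⟩
  exact ⟨(⟨i, by omega⟩, ⟨j, by omega⟩, ⟨l, by omega⟩), rfl⟩

theorem coeff_linear_pow {K : Type*} [Field K] (a b : K) (i j : ℕ) :
    coeff (expVec 0 i j) ((C a * X 1 + C b * X 2 : MvPolynomial (Fin 3) K) ^ (i + j))
      = (i + j).choose i * a ^ i * b ^ j := by
  have key : ∀ m ∈ Finset.range (i + j + 1),
      coeff (expVec 0 i j) ((C a * X 1 : MvPolynomial (Fin 3) K) ^ m * (C b * X 2) ^ (i + j - m) *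
        ((i + j).choose m : MvPolynomial (Fin 3) K)) =
      if m = i then (i + j).choose i * a ^ i * b ^ j else 0 := by
    intro m hm
    have e : (C a * X 1 : MvPolynomial (Fin 3) K) ^ m * (C b * X 2) ^ (i + j - m) *
        ((i + j).choose m : MvPolynomial (Fin 3) K) =
        C ((i + j).choose m * a ^ m * b ^ (i + j - m)) *
          (X 0 ^ 0 * X 1 ^ m * X 2 ^ (i + j - m)) := by
      simp only [mul_pow, map_mul, map_pow, map_natCast]; ring
    rw [e, X_pow_mul_eq_monomial, coeff_C_mul, coeff_monomial]
    simp only [expVec_inj]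
    split_ifs with h1 h2 h2
    · subst h2; simp
    · omega
    · subst h2; simp at h1
    · simp
  rw [add_pow, coeff_sum, Finset.sum_congr rfl key]
  simp

theorem exists_linear_form {K : Type*} [Field K] [CharZero K] {ℓ : MvPolynomial (Fin 3) K}
    (hhom : ℓ.IsHomogeneous 1) (hyz : pderiv 0 ℓ = 0) :
    ∃ a b : K, ℓ = C a * X 1 + C b * X 2 := by
  refine ⟨coeff (Finsupp.single 1 1) ℓ, coeff (Finsupp.single 2 1) ℓ, ?_⟩
  have hx : coeff (Finsupp.single 0 1) ℓ = 0 := by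
    have h := (coeff_iterate_pderiv_eq_zero_iff 0 1 0 ℓ).1 (by simp [hyz])
    simpa using h
  ext m
  by_cases hm : m.degree = 1
  · obtain ⟨i, rfl⟩ := (Finsupp.sum_eq_one_iff m).1 hm
    fin_cases i <;> simp [coeff_C_mul, coeff_X, Finsupp.single_left_inj, hx]
  · rw [hhom.coeff_eq_zero hm,
      ((isHomogeneous_C_mul_X _ _).add (isHomogeneous_C_mul_X _ _)).coeff_eq_zero hm]

/-- A lower bound for the apolar length from a family of derivatives of orders `e i` and a family of
exponents `m i` for which the matrix of coefficients is, in each order, triangular with respect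
to `r`. -/
theorem card_le_apolarLength {ι K : Type*} [Fintype ι] [Field K] [CharZero K]
    (F : MvPolynomial (Fin 3) K) (m e : ι → ℕ × ℕ × ℕ) (r : ι → ℕ)
    (hdeg : ∀ i, (e i).1 + (e i).2.1 + (e i).2.2 ≤ F.totalDegree)
    (hd : ∀ i, coeff (expVec ((m i).1 + (e i).1) ((m i).2.1 + (e i).2.1)
      ((m i).2.2 + (e i).2.2)) F ≠ 0)
    (h0 : ∀ i j, i ≠ j →
      (e i).1 + (e i).2.1 + (e i).2.2 = (e j).1 + (e j).2.1 + (e j).2.2 → r i ≤ r j →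
      coeff (expVec ((m i).1 + (e j).1) ((m i).2.1 + (e j).2.1) ((m i).2.2 + (e j).2.2)) F = 0) :
    Fintype.card ι ≤ apolarLength K F := by
  classical
  rw [apolarLength, ← Finset.card_univ, Finset.card_eq_sum_card_fiberwise
    (f := fun i => (e i).1 + (e i).2.1 + (e i).2.2) (t := Finset.range (F.totalDegree + 1))
    (fun i _ => by simpa [Nat.lt_succ_iff] using hdeg i)]
  refine Finset.sum_le_sum fun n _ => ?_
  let s := {i : ι // (e i).1 + (e i).2.1 + (e i).2.2 = n}
  let D : s → MvPolynomial (Fin 3) K := fun i =>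
    (⇑(pderiv (0 : Fin 3)))^[(e i).1] ((⇑(pderiv (1 : Fin 3)))^[(e i).2.1]
      ((⇑(pderiv (2 : Fin 3)))^[(e i).2.2] F))
  have hD : LinearIndependent K D := by
    refine linearIndependent_of_triangular D
      (fun i => lcoeff K (expVec (m i).1 (m i).2.1 (m i).2.2)) (fun i => r i) ?_ ?_
    · intro i h
      exact hd i ((coeff_iterate_pderiv_expVec _ _ _ _ _ _ F).1 h)
    · intro i j hij hr
      exact (coeff_iterate_pderiv_expVec _ _ _ _ _ _ F).2
        (h0 i j (fun h => hij (Subtype.ext h)) (i.2.trans j.2.symm) hr)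
  have hmem : ∀ i, D i ∈ derivSpan K n F := fun i =>
    Submodule.subset_span ⟨_, _, _, i.2, rfl⟩
  let D' : s → derivSpan K n F := fun i => ⟨D i, hmem i⟩
  have hD' : LinearIndependent K D' := LinearIndependent.of_comp (derivSpan K n F).subtype hD
  have := hD'.fintype_card_le_finrank
  rwa [Fintype.card_subtype] at this

theorem lt_apolarLength_of_coeff {K : Type*} [Field K] [CharZero K] {k : ℕ} (hk : 1 ≤ k)
    (F : MvPolynomial (Fin 3) K)
    (h1 : coeff (expVec 1 (k - 1) (k + 2)) F ≠ 0)
    (h2 : ∀ a b c, ¬ (a = 0 ∧ b = k - 1 ∧ c = k + 2) → coeff (expVec (a + 1) b c) F = 0)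
    {p q : ℕ} (hpq : p + q = 2) (h3 : coeff (expVec 0 (2 * k + q) p) F ≠ 0) :
    2 * k ^ 2 + 6 * k + 2 < apolarLength K F := by
  have hdeg : 2 * k + 2 ≤ F.totalDegree := by
    refine le_trans (le_of_eq ?_) (le_totalDegree (mem_support_iff.2 h1))
    rw [Finsupp.sum_fintype _ _ (fun _ => rfl), Fin.sum_univ_three]
    simp [expVec]
    omega
  let m : (Fin k × Fin (k + 3)) ⊕ (Fin k × Fin (k + 3)) ⊕ Fin 3 → ℕ × ℕ × ℕ :=
    Sum.elim (fun u => (1, k - 1 - u.1, k + 2 - u.2)) (Sum.elim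
      (fun u => (0, k - 1 - u.1, k + 2 - u.2))
      (fun t => (0, k + q - ((t : ℕ) - min (t : ℕ) p), p - min (t : ℕ) p)))
  let e : (Fin k × Fin (k + 3)) ⊕ (Fin k × Fin (k + 3)) ⊕ Fin 3 → ℕ × ℕ × ℕ :=
    Sum.elim (fun u => (0, u.1, u.2)) (Sum.elim (fun u => (1, u.1, u.2))
      (fun t => (0, k + ((t : ℕ) - min (t : ℕ) p), min (t : ℕ) p)))
  let r : (Fin k × Fin (k + 3)) ⊕ (Fin k × Fin (k + 3)) ⊕ Fin 3 → ℕ :=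
    Sum.elim (fun _ => 0) (Sum.elim (fun _ => 2) (fun _ => 1))
  have h := card_le_apolarLength F m e r ?_ ?_ ?_
  · simp only [Fintype.card_sum, Fintype.card_prod, Fintype.card_fin] at h
    nlinarith
  · rintro (⟨i, j⟩ | ⟨i, j⟩ | t) <;> simp [e] <;> omega
  · rintro (⟨i, j⟩ | ⟨i, j⟩ | t) <;> simp only [m, e, Sum.elim_inl, Sum.elim_inr]
    · convert h1 using 3 <;> omega
    · convert h1 using 3 <;> omega
    · convert h3 using 3 <;> omega
  · have h2' : ∀ a b c, ¬ (a = 1 ∧ b = k - 1 ∧ c = k + 2) → 1 ≤ a →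
        coeff (expVec a b c) F = 0 := by
      intro a b c h ha
      obtain ⟨a, rfl⟩ := Nat.exists_eq_add_of_le' ha
      exact h2 a b c (by omega)
    rintro (⟨i, j⟩ | ⟨i, j⟩ | t) (⟨i', j'⟩ | ⟨i', j'⟩ | t') hne hdeg' hr <;>
      simp only [m, e, r, Sum.elim_inl, Sum.elim_inr, ne_eq, Sum.inl.injEq, Sum.inr.injEq,
        Prod.mk.injEq, Fin.ext_iff] at hne hdeg' hr ⊢ <;>
      exact h2' _ _ _ (by omega) (by omega)

theorem eq_zero_of_power_sums_eq_zero {K : Type*} [Field K] {a₀ a₁ b₀ b₁ c₀ c₁ : K} {n : ℕ}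
    (hn : n ≠ 0) (hdet : a₀ * b₁ - a₁ * b₀ ≠ 0)
    (h0 : c₀ * a₀ ^ (n + 2) + c₁ * a₁ ^ (n + 2) = 0)
    (h1 : c₀ * (a₀ ^ (n + 1) * b₀) + c₁ * (a₁ ^ (n + 1) * b₁) = 0) :
    c₀ * (a₀ ^ n * b₀ ^ 2) + c₁ * (a₁ ^ n * b₁ ^ 2) = 0 := by
  have e0 : c₀ * a₀ ^ (n + 1) = 0 := by
    refine (mul_eq_zero.1 ?_).resolve_right hdet
    linear_combination b₁ * h0 - a₁ * h1
  have e1 : c₁ * a₁ ^ (n + 1) = 0 := by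
    refine (mul_eq_zero.1 ?_).resolve_right hdet
    linear_combination a₀ * h1 - b₀ * h0
  have f0 : c₀ * a₀ ^ n = 0 := by
    rcases mul_eq_zero.1 e0 with h | h
    · simp [h]
    · simp [eq_zero_of_pow_eq_zero h, hn]
  have f1 : c₁ * a₁ ^ n = 0 := by
    rcases mul_eq_zero.1 e1 with h | h
    · simp [h]
    · simp [eq_zero_of_pow_eq_zero h, hn]
  linear_combination b₀ ^ 2 * f0 + b₁ ^ 2 * f1

theorem det_ne_zero_of_linearIndependent {K : Type*} [Field K] {a b : Fin 2 → K}
    {ℓ : Fin 2 → MvPolynomial (Fin 3) K} (hind : LinearIndependent K ℓ)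
    (hℓ : ∀ i, ℓ i = C (a i) * X 1 + C (b i) * X 2) : a 0 * b 1 - a 1 * b 0 ≠ 0 := by
  intro h
  have hp := LinearIndependent.pair_iff.1 (by
    convert hind using 1; ext i : 1; fin_cases i <;> rfl : LinearIndependent K ![ℓ 0, ℓ 1])
  have hC : C (a 0) * C (b 1) - C (a 1) * C (b 0) = (0 : MvPolynomial (Fin 3) K) := by
    rw [← C_mul, ← C_mul, ← C_sub, h, C_0]
  have ha := hp (a 1) (-a 0) (by
    simp only [smul_eq_C_mul, hℓ, C_neg]
    linear_combination (-X 2) * hC)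
  have hb := hp (b 1) (-b 0) (by
    simp only [smul_eq_C_mul, hℓ, C_neg]
    linear_combination X 1 * hC)
  apply hind.ne_zero 0
  rw [hℓ, neg_eq_zero.1 ha.2, neg_eq_zero.1 hb.2]
  simp

/-- If `H` is a linear combination of at most two `(2k+2)`-nd powers of pairwise
linearly independent linear forms in `y, z`, then
`Fα = x·y^{k-1}·z^{k+2} + y^{2k}·z² − H` has apolar length `> 2k² + 6k + 2`. -/
theorem apolarLength_Falpha_gt (K : Type*) [Field K] [IsAlgClosed K] [CharZero K]
    (k : ℕ) (hk : 1 ≤ k)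
    (c : Fin 2 → K) (ℓ : Fin 2 → MvPolynomial (Fin 3) K)
    (hhom : ∀ i, (ℓ i).IsHomogeneous 1)
    (hyz : ∀ i, pderiv 0 (ℓ i) = 0)
    (hind : LinearIndependent K ℓ)
    (H : MvPolynomial (Fin 3) K)
    (hH : H = c 0 • ℓ 0 ^ (2 * k + 2) + c 1 • ℓ 1 ^ (2 * k + 2)) :
    2 * k ^ 2 + 6 * k + 2 <
      apolarLength K
        (X 0 * X 1 ^ (k - 1) * X 2 ^ (k + 2) + X 1 ^ (2 * k) * X 2 ^ 2 - H) := by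
  choose a b hℓ using fun i => exists_linear_form (hhom i) (hyz i)
  have hdet := det_ne_zero_of_linearIndependent hind hℓ
  have hHx : ∀ i j l, coeff (expVec (i + 1) j l) H = 0 := by
    intro i j l
    have hder : pderiv 0 H = 0 := by
      simp [hH, Derivation.leibniz_pow, hyz]
    exact (coeff_iterate_pderiv_expVec i j l 1 0 0 H).1 (by simp [hder])
  have hHyz : ∀ i j, i + j = 2 * k + 2 → coeff (expVec 0 i j) H =
      (2 * k + 2).choose i * (c 0 * (a 0 ^ i * b 0 ^ j) + c 1 * (a 1 ^ i * b 1 ^ j)) := by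
    intro i j hij
    rw [hH, coeff_add, coeff_smul, coeff_smul, hℓ, hℓ, ← hij, coeff_linear_pow,
      coeff_linear_pow, smul_eq_mul, smul_eq_mul]
    ring
  have hF : ∀ i j l, coeff (expVec i j l)
      (X 0 * X 1 ^ (k - 1) * X 2 ^ (k + 2) + X 1 ^ (2 * k) * X 2 ^ 2 - H) =
      (if 1 = i ∧ k - 1 = j ∧ k + 2 = l then 1 else 0) +
      (if 0 = i ∧ 2 * k = j ∧ 2 = l then 1 else 0) - coeff (expVec i j l) H := by
    intro i j l
    have e1 := X_pow_mul_eq_monomial K 1 (k - 1) (k + 2)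
    have e2 := X_pow_mul_eq_monomial K 0 (2 * k) 2
    rw [pow_one] at e1
    rw [pow_zero, one_mul] at e2
    rw [e1, e2, coeff_sub, coeff_add, coeff_monomial, coeff_monomial]
    simp only [expVec_inj]
  have hex : ∃ p q, p + q = 2 ∧ coeff (expVec 0 (2 * k + q) p)
      (X 0 * X 1 ^ (k - 1) * X 2 ^ (k + 2) + X 1 ^ (2 * k) * X 2 ^ 2 - H) ≠ 0 := by
    by_contra! hcon
    have h0 := hcon 0 2 rfl
    have h1 := hcon 1 1 rfl
    have h2 := hcon 2 0 rfl
    have hchoose : ∀ i, i ≤ 2 * k + 2 → ((2 * k + 2).choose i : K) ≠ 0 := fun i hi =>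
      Nat.cast_ne_zero.2 (Nat.choose_pos hi).ne'
    rw [hF, hHyz _ _ (by omega)] at h0 h1 h2
    rw [if_neg (by omega), if_neg (by omega), zero_add, zero_sub, neg_eq_zero, mul_eq_zero] at h0 h1
    have h0' := h0.resolve_left (hchoose _ le_rfl)
    have h1' := h1.resolve_left (hchoose _ (by omega))
    simp only [pow_zero, mul_one] at h0'
    simp only [pow_one] at h1'
    rw [add_zero, eq_zero_of_power_sums_eq_zero (n := 2 * k) (by omega) hdet h0' h1'] at h2
    simp at h2
  obtain ⟨p, q, hpq, h3⟩ := hex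
  refine lt_apolarLength_of_coeff hk _ ?_ ?_ hpq h3
  · rw [hF, hHx 0]
    simp
  · intro i j l h
    rw [hF, hHx, if_neg (by omega), if_neg (by omega)]
    simp
end
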